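/- Let A be symmetric with Ā := (tr(A)I - A)/2 positive definite, let U_A(X) := tr(A(I - X))/(4λ_max(Ā)), and for q in a finite index set let Γ_A(X,q) := X · R_a(2 arcsin(k U_A(X)), ν(q)) where ν(q) ∈ S² and 0 < k < 1/√(6 - max{1, 4ξ²}) with ξ = λ_min(Ā)/λ_max(Ā). Then for all X in SO(3) and all q: (1 - k² - k√(1-k²))·|X|_I² ≤ |Γ_A(X,q)|_I² ≤ (1 + k + k²/4)·|X|_I². -/

import Mathlib

open Matrix

noncomputable def skew (u : Fin 3 → ℝ) : Matrix (Fin 3) (Fin 3) ℝ :=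
  !![0, -u 2, u 1; u 2, 0, -u 0; -u 1, u 0, 0]

/-- `Ā = (tr(A)·I - A)/2`. -/
noncomputable def barM (A : Matrix (Fin 3) (Fin 3) ℝ) : Matrix (Fin 3) (Fin 3) ℝ :=
  (1 / 2 : ℝ) • (A.trace • (1 : Matrix (Fin 3) (Fin 3) ℝ) - A)

/-- Angle-axis rotation (Rodrigues formula). -/
noncomputable def Ra (θ : ℝ) (u : Fin 3 → ℝ) : Matrix (Fin 3) (Fin 3) ℝ :=
  1 + Real.sin θ • skew u + (1 - Real.cos θ) • (skew u) ^ 2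

/-- The rotation matrix of the unit quaternion `η + x i + y j + z k`. -/
def quatRot (η x y z : ℝ) : Matrix (Fin 3) (Fin 3) ℝ :=
  !![1 - 2 * (y ^ 2 + z ^ 2), 2 * (x * y - η * z), 2 * (x * z + η * y);
     2 * (x * y + η * z), 1 - 2 * (x ^ 2 + z ^ 2), 2 * (y * z - η * x);
     2 * (x * z - η * y), 2 * (y * z + η * x), 1 - 2 * (x ^ 2 + y ^ 2)]

/-- A symmetric array whose rows are proportional and with positive trace is a rank one square. -/
theorem exists_eq_mul_of_rank_one {ι : Type*} [Fintype ι] (N : ι → ι → ℝ)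
    (hN : ∀ i j l, N i j * N i l = N i i * N j l) (htr : 0 < ∑ i, N i i) :
    ∃ v : ι → ℝ, ∀ i j, N i j = v i * v j := by
  obtain ⟨i, -, hi⟩ := Finset.exists_lt_of_sum_lt (s := Finset.univ) (f := fun _ => (0 : ℝ))
    (g := fun i => N i i) (by simpa using htr)
  refine ⟨fun j => N i j / √(N i i), fun j l => ?_⟩
  have hs : √(N i i) * √(N i i) = N i i := Real.mul_self_sqrt hi.le
  rw [div_mul_div_comm, hs, hN, mul_div_cancel_left₀ _ hi.ne']

/-- Every rotation matrix comes from a unit quaternion. -/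
theorem exists_eq_quatRot (X : Matrix (Fin 3) (Fin 3) ℝ) (hX : Xᵀ * X = 1) (hdet : X.det = 1) :
    ∃ η x y z : ℝ, η ^ 2 + (x ^ 2 + y ^ 2 + z ^ 2) = 1 ∧ X = quatRot η x y z := by
  have hX' : X * Xᵀ = 1 := mul_eq_one_comm.mp hX
  have hadj : X.adjugate = Xᵀ := by
    calc X.adjugate = Xᵀ * X * X.adjugate := by rw [hX, one_mul]
      _ = Xᵀ := by rw [Matrix.mul_assoc, Matrix.mul_adjugate, hdet, one_smul, mul_one]
  rw [Matrix.adjugate_fin_three] at hadj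
  have h1 := fun i j => congrFun (congrFun hX i) j
  have h2 := fun i j => congrFun (congrFun hX' i) j
  have h3 := fun i j => congrFun (congrFun hadj i) j
  simp [Fin.forall_fin_succ, Matrix.mul_apply, Fin.sum_univ_three] at h1 h2 h3
  obtain ⟨⟨a1, a2, a3⟩, ⟨a4, a5, a6⟩, a7, a8, a9⟩ := h1
  obtain ⟨⟨b1, b2, b3⟩, ⟨b4, b5, b6⟩, b7, b8, b9⟩ := h2
  obtain ⟨⟨c1, c2, c3⟩, ⟨c4, c5, c6⟩, c7, c8, c9⟩ := h3
  obtain ⟨v, hv⟩ := exists_eq_mul_of_rank_one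
    (!![1 + X 0 0 + X 1 1 + X 2 2, X 2 1 - X 1 2, X 0 2 - X 2 0, X 1 0 - X 0 1;
        X 2 1 - X 1 2, 1 + X 0 0 - X 1 1 - X 2 2, X 0 1 + X 1 0, X 0 2 + X 2 0;
        X 0 2 - X 2 0, X 0 1 + X 1 0, 1 + X 1 1 - X 0 0 - X 2 2, X 1 2 + X 2 1;
        X 1 0 - X 0 1, X 0 2 + X 2 0, X 1 2 + X 2 1, 1 + X 2 2 - X 0 0 - X 1 1] :
        Matrix (Fin 4) (Fin 4) ℝ)
    (by
      simp only [Fin.forall_fin_succ]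
      simp
      refine ⟨?_, ?_, ?_, ?_⟩ <;> (repeat' apply And.intro) <;> linarith)
    (by
      simp [Fin.sum_univ_four]
      ring_nf
      norm_num)
  simp [Fin.forall_fin_succ] at hv
  obtain ⟨⟨n1, n2, n3, n4⟩, ⟨n5, n6, n7, n8⟩, ⟨n9, n10, n11, n12⟩, n13, n14, n15, n16⟩ := hv
  refine ⟨v 0 / 2, v 1 / 2, v 2 / 2, v 3 / 2, by linarith, ?_⟩
  ext i j
  fin_cases i <;> fin_cases j <;> simp [quatRot] <;> linarith

theorem trace_one_sub_quatRot (η x y z : ℝ) :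
    (1 - quatRot η x y z).trace / 4 = x ^ 2 + y ^ 2 + z ^ 2 := by
  simp [quatRot, Matrix.trace, Fin.sum_univ_three]
  ring

theorem trace_mul_one_sub_quatRot {A : Matrix (Fin 3) (Fin 3) ℝ} (hA : Aᵀ = A) (η x y z : ℝ) :
    (A * (1 - quatRot η x y z)).trace = 4 * (![x, y, z] ⬝ᵥ (barM A *ᵥ ![x, y, z])) := by
  have h01 : A 1 0 = A 0 1 := congrFun (congrFun hA 0) 1
  have h02 : A 2 0 = A 0 2 := congrFun (congrFun hA 0) 2
  have h12 : A 2 1 = A 1 2 := congrFun (congrFun hA 1) 2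
  simp [quatRot, barM, Matrix.trace, Fin.sum_univ_three, Matrix.mul_apply, dotProduct,
    Matrix.mulVec, h01, h02, h12]
  ring

/-- The scalar part of the product of two unit quaternions, read off the trace. -/
theorem trace_one_sub_quatRot_mul_Ra {η x y z t c θ : ℝ} {u : Fin 3 → ℝ} (hu : u ⬝ᵥ u = 1)
    (hη : η ^ 2 + (x ^ 2 + y ^ 2 + z ^ 2) = 1) (htc : t ^ 2 + c ^ 2 = 1)
    (hsin : Real.sin θ = 2 * t * c) (hcos : Real.cos θ = 1 - 2 * t ^ 2) :
    (1 - quatRot η x y z * Ra θ u).trace / 4 =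
      1 - (η * c - t * (x * u 0 + y * u 1 + z * u 2)) ^ 2 := by
  simp [dotProduct, Fin.sum_univ_three] at hu
  simp [quatRot, Ra, skew, Matrix.trace, Fin.sum_univ_three, Matrix.vecMul, dotProduct, pow_two,
    hsin, hcos]
  linear_combination (-t ^ 2 * (x ^ 2 + y ^ 2 + z ^ 2 - 1)) * hu + c ^ 2 * hη
    - (x ^ 2 + y ^ 2 + z ^ 2 - 1) * htc

theorem dotProduct_mulVec_le_iSup_eigenvalues {n : Type*} [Fintype n] [DecidableEq n]
    {M : Matrix n n ℝ} (hM : M.IsHermitian) (v : n → ℝ) :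
    v ⬝ᵥ (M *ᵥ v) ≤ (⨆ i, hM.eigenvalues i) * (v ⬝ᵥ v) := by
  set L := ⨆ i, hM.eigenvalues i
  let U : Matrix n n ℝ := hM.eigenvectorUnitary
  have hU : U * Uᴴ = 1 := Unitary.coe_mul_star_self _
  have hspec : M = U * diagonal hM.eigenvalues * Uᴴ := hM.spectral_theorem
  have hdiag : (diagonal fun i => L - hM.eigenvalues i).PosSemidef :=
    PosSemidef.diagonal fun i => sub_nonneg.mpr (le_ciSup (Set.finite_range _).bddAbove i)
  have heq : U * (diagonal fun i => L - hM.eigenvalues i) * Uᴴ = L • 1 - M := by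
    have : (diagonal fun i => L - hM.eigenvalues i) = L • 1 - diagonal hM.eigenvalues := by
      rw [smul_one_eq_diagonal, diagonal_sub]
    rw [this, Matrix.mul_sub, Matrix.sub_mul, ← hspec, Matrix.mul_smul, Matrix.smul_mul,
      Matrix.mul_one, hU]
  have h := (hdiag.mul_mul_conjTranspose_same U).dotProduct_mulVec_nonneg v
  rw [heq, Matrix.sub_mulVec, Matrix.smul_mulVec, Matrix.one_mulVec, dotProduct_sub,
    dotProduct_smul] at h
  simpa using h

theorem sq_scalar_part_bounds {η s e t c k : ℝ} (hη : η ^ 2 + s = 1) (he : e ^ 2 ≤ s)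
    (ht0 : 0 ≤ t) (htk : t ≤ k * s) (htc : t ^ 2 + c ^ 2 = 1) (hc : 0 ≤ c)
    (hk0 : 0 < k) (hk1 : k ≤ 1) :
    (1 - k ^ 2 - k * √(1 - k ^ 2)) * s ≤ 1 - (η * c - t * e) ^ 2 ∧
      1 - (η * c - t * e) ^ 2 ≤ (1 + k + k ^ 2 / 4) * s := by
  have hs0 : 0 ≤ s := (sq_nonneg e).trans he
  have hs1 : s ≤ 1 := by nlinarith [sq_nonneg η]
  have hexp : 1 - (η * c - t * e) ^ 2
      = s + t ^ 2 * (1 - s) + t * (2 * (η * e) * c) - t ^ 2 * e ^ 2 := by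
    linear_combination (-c ^ 2) * hη - (1 - s) * htc
  constructor
  · set w := √(1 - k ^ 2)
    have hw0 : 0 ≤ w := Real.sqrt_nonneg _
    have hw : w ^ 2 = 1 - k ^ 2 := Real.sq_sqrt (by nlinarith)
    have hkw : 1 ≤ k + w := by nlinarith [mul_nonneg hk0.le hw0]
    have hab : (e ^ 2 + η ^ 2) ^ 2 ≤ 1 := by
      have : e ^ 2 + η ^ 2 ≤ 1 := by linarith
      nlinarith [sq_nonneg e, sq_nonneg η]
    have hcs : (e ^ 2 - η ^ 2) * t - 2 * (η * e) * c ≤ 1 := by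
      refine (abs_le.mp ((sq_le_one_iff_abs_le_one _).mp ?_)).2
      calc ((e ^ 2 - η ^ 2) * t - 2 * (η * e) * c) ^ 2
          ≤ (e ^ 2 + η ^ 2) ^ 2 * (t ^ 2 + c ^ 2) := by
            linarith [sq_nonneg ((e ^ 2 - η ^ 2) * c + 2 * (η * e) * t)]
        _ ≤ 1 := by rw [htc, mul_one]; exact hab
    have h1 : t * ((e ^ 2 - η ^ 2) * t - 2 * (η * e) * c) ≤ t * 1 :=
      mul_le_mul_of_nonneg_left hcs ht0
    have h2 : k * s * 1 ≤ k * s * (k + w) :=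
      mul_le_mul_of_nonneg_left hkw (by positivity)
    have h3 : t ^ 2 * (1 - s) = t ^ 2 * η ^ 2 := by rw [← hη]; ring
    rw [hexp, h3]
    linarith
  · have hηe : 2 * (η * e) ≤ 1 := by nlinarith [sq_nonneg (η - e)]
    have hc1 : c ≤ 1 := by nlinarith
    have h1 : 2 * (η * e) * c ≤ 1 := by nlinarith
    have h2 : t * (2 * (η * e) * c) ≤ t * 1 := mul_le_mul_of_nonneg_left h1 ht0
    have h3 : t ^ 2 * (1 - s) ≤ (k * s) ^ 2 * (1 - s) :=
      mul_le_mul_of_nonneg_right (pow_le_pow_left₀ ht0 htk 2) (by linarith)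
    have h4 : k ^ 2 * s * (s * (1 - s)) ≤ k ^ 2 * s * (1 / 4) :=
      mul_le_mul_of_nonneg_left (by nlinarith [sq_nonneg (s - 1 / 2)]) (by positivity)
    have h5 : 0 ≤ t ^ 2 * e ^ 2 := by positivity
    rw [hexp]
    linarith

theorem lt_one_of_lt_one_div_sqrt {k r : ℝ} (hr0 : 0 ≤ r) (hr1 : r ≤ 1)
    (hk : k < 1 / √(6 - max 1 (4 * r ^ 2))) : k < 1 := by
  have hmax : max 1 (4 * r ^ 2) ≤ 4 := max_le (by norm_num) (by nlinarith)
  have hsqrt : 1 ≤ √(6 - max 1 (4 * r ^ 2)) := Real.one_le_sqrt.mpr (by linarith)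
  exact hk.trans_le ((div_le_one (by linarith)).mpr hsqrt)

theorem angular_warping_bounds (A : Matrix (Fin 3) (Fin 3) ℝ)
    (hA : Aᵀ = A) (hH : (barM A).IsHermitian) (hPD : (barM A).PosDef)
    (Q : Type*) [Fintype Q] (ν : Q → Fin 3 → ℝ) (hν : ∀ q, ν q ⬝ᵥ ν q = 1)
    (k : ℝ)
    (hk0 : 0 < k)
    (hk1 : k < 1 / Real.sqrt (6 - max 1
      (4 * ((⨅ i, hH.eigenvalues i) / (⨆ i, hH.eigenvalues i)) ^ 2)))
    (X : Matrix (Fin 3) (Fin 3) ℝ) (hX : Xᵀ * X = 1) (hdet : X.det = 1) (q : Q) :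
    (1 - k ^ 2 - k * Real.sqrt (1 - k ^ 2)) * ((1 - X).trace / 4)
      ≤ (1 - X * Ra (2 * Real.arcsin (k * ((A * (1 - X)).trace / (4 * ⨆ i, hH.eigenvalues i)))) (ν q)).trace / 4
    ∧ (1 - X * Ra (2 * Real.arcsin (k * ((A * (1 - X)).trace / (4 * ⨆ i, hH.eigenvalues i)))) (ν q)).trace / 4
      ≤ (1 + k + k ^ 2 / 4) * ((1 - X).trace / 4) := by
  have hpos := hPD.eigenvalues_pos
  have hbdd : BddAbove (Set.range hH.eigenvalues) := (Set.finite_range _).bddAbove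
  have hbdd' : BddBelow (Set.range hH.eigenvalues) := (Set.finite_range _).bddBelow
  have hL : 0 < ⨆ i, hH.eigenvalues i := (hpos 0).trans_le (le_ciSup hbdd 0)
  have hl : 0 ≤ ⨅ i, hH.eigenvalues i := le_ciInf fun i => (hpos i).le
  have hlL : (⨅ i, hH.eigenvalues i) ≤ ⨆ i, hH.eigenvalues i :=
    (ciInf_le hbdd' 0).trans (le_ciSup hbdd 0)
  have hk : k < 1 := lt_one_of_lt_one_div_sqrt (div_nonneg hl hL.le) ((div_le_one hL).mpr hlL) hk1
  obtain ⟨η, x, y, z, hη, rfl⟩ := exists_eq_quatRot X hX hdet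
  have hquad := dotProduct_mulVec_le_iSup_eigenvalues hH ![x, y, z]
  have hquad0 : 0 ≤ ![x, y, z] ⬝ᵥ (barM A *ᵥ ![x, y, z]) := by
    simpa using hPD.posSemidef.dotProduct_mulVec_nonneg ![x, y, z]
  have hnorm : ![x, y, z] ⬝ᵥ ![x, y, z] = x ^ 2 + y ^ 2 + z ^ 2 := by
    simp [dotProduct, Fin.sum_univ_three]
    ring
  rw [hnorm] at hquad
  rw [trace_mul_one_sub_quatRot hA, mul_div_mul_left _ _ (four_ne_zero' ℝ)]
  set L := ⨆ i, hH.eigenvalues i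
  set U := ![x, y, z] ⬝ᵥ (barM A *ᵥ ![x, y, z]) / L
  have hU0 : 0 ≤ U := div_nonneg hquad0 hL.le
  have hUs : U ≤ x ^ 2 + y ^ 2 + z ^ 2 := (div_le_iff₀ hL).mpr (by linarith)
  have ht0 : 0 ≤ k * U := mul_nonneg hk0.le hU0
  have htk : k * U ≤ k * (x ^ 2 + y ^ 2 + z ^ 2) := mul_le_mul_of_nonneg_left hUs hk0.le
  have ht1 : k * U ≤ 1 := by nlinarith [sq_nonneg η]
  have hsin : Real.sin (Real.arcsin (k * U)) = k * U := Real.sin_arcsin (by linarith) ht1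
  have htc := Real.sin_sq_add_cos_sq (Real.arcsin (k * U))
  have hcos := Real.cos_sq' (Real.arcsin (k * U))
  have hu := hν q
  rw [hsin] at htc hcos
  rw [trace_one_sub_quatRot, trace_one_sub_quatRot_mul_Ra hu hη htc
    (by rw [Real.sin_two_mul, hsin]) (by rw [Real.cos_two_mul, hcos]; ring)]
  refine sq_scalar_part_bounds hη ?_ ht0 htk htc (Real.cos_arcsin_nonneg _) hk0 hk.le
  simp [dotProduct, Fin.sum_univ_three] at hu
  have hlag : (x * ν q 0 + y * ν q 1 + z * ν q 2) ^ 2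
      ≤ (x ^ 2 + y ^ 2 + z ^ 2) * (ν q 0 * ν q 0 + ν q 1 * ν q 1 + ν q 2 * ν q 2) := by
    linarith [sq_nonneg (x * ν q 1 - y * ν q 0), sq_nonneg (x * ν q 2 - z * ν q 0),
      sq_nonneg (y * ν q 2 - z * ν q 1)]
  rwa [hu, mul_one] at hlag
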